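/- arXiv:2404.16314 — 7 statements merged into one kernel-verified Lean document; each statement's English description precedes it below -/
import Mathlib

section
/- Correctness of the Cordon Algorithm: for every round r ≥ 0, every state i in the ready set F_r satisfies T_r(i) = D(i); consequently T_r(i) = D(i) for every finalized state i ∈ S_r and every round r, and moreover T_r(i) ≥ D(i) holds for all states i and all rounds r. -/
/-- **Correctness of the Cordon Algorithm.**
A DP instance on states `0,…,n−1` is given by an edge set `E` (with
`E j i → j < i < n`, so the integer order is topological), transition
functions `f j i : α → α` for edges, and boundary values `b`.  The true DP
values `D` satisfy `D i = min (b i) (min {f j i (D j) : E j i})` (stated as a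
minimum characterization).  The Cordon Algorithm maintains finalized sets
`S r` and tentative tables `T r`: `S 0 = ∅`, `T 0 = b`; the sentinel set
`Z r` consists of tentative states successfully relaxable by a tentative
state; the ready set `F r` consists of tentative states none of whose
ancestors (under reflexive-transitive closure of `E`) carries a sentinel;
`T (r+1) i` is the minimum of `T r i` and all `f j i (T r j)` over edges
`j → i` with `j ∈ F r`; and `S (r+1) = S r ∪ F r`.

Then every ready state's tentative value is its true DP value, hence so is
every finalized state's, and moreover `T r i ≥ D i` for all states and
rounds. -/
theorem cordon_algorithm_correct {α : Type*} [LinearOrder α] (n : ℕ)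
    (E : ℕ → ℕ → Prop) (hE : ∀ j i : ℕ, E j i → j < i ∧ i < n)
    (f : ℕ → ℕ → α → α) (b : ℕ → α) (D : ℕ → α)
    (hD : ∀ i : ℕ, i < n →
      D i ≤ b i ∧ (∀ j : ℕ, E j i → D i ≤ f j i (D j)) ∧
      (D i = b i ∨ ∃ j : ℕ, E j i ∧ D i = f j i (D j)))
    (S Z F : ℕ → Set ℕ) (T : ℕ → ℕ → α)
    (hS0 : S 0 = ∅) (hT0 : ∀ i : ℕ, T 0 i = b i)
    (hZ : ∀ r i : ℕ, i ∈ Z r ↔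
      i ∉ S r ∧ ∃ j : ℕ, j ∉ S r ∧ E j i ∧ f j i (T r j) < T r i)
    (hF : ∀ r i : ℕ, i ∈ F r ↔
      i < n ∧ i ∉ S r ∧ ∀ j : ℕ, Relation.ReflTransGen E j i → j ∉ Z r)
    (hT : ∀ r i : ℕ,
      T (r + 1) i ≤ T r i ∧
      (∀ j : ℕ, E j i → j ∈ F r → T (r + 1) i ≤ f j i (T r j)) ∧
      (T (r + 1) i = T r i ∨
        ∃ j : ℕ, E j i ∧ j ∈ F r ∧ T (r + 1) i = f j i (T r j)))
    (hSsucc : ∀ r : ℕ, S (r + 1) = S r ∪ F r) :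
    (∀ r i : ℕ, i ∈ F r → T r i = D i) ∧
    (∀ r i : ℕ, i ∈ S r → T r i = D i) ∧
    (∀ r i : ℕ, i < n → D i ≤ T r i) := by
  have ready : ∀ r : ℕ, (∀ i, i < n → D i ≤ T r i) → (∀ i, T r i ≤ b i) →
      (∀ j i, j ∈ S r → E j i → T r i ≤ f j i (D j)) → ∀ i, i ∈ F r → T r i = D i := by
    intro r hlower hb hrelaxed i
    induction i using Nat.strong_induction_on with
    | _ i ih =>
      intro hi
      obtain ⟨hin, hiS, hanc⟩ := (hF r i).1 hi
      refine le_antisymm ?_ (hlower i hin)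
      rcases (hD i hin).2.2 with h | ⟨j, hji, h⟩
      · exact h ▸ hb i
      · rw [h]
        by_cases hjS : j ∈ S r
        · exact hrelaxed j i hjS hji
        · have hjF : j ∈ F r := (hF r j).2
            ⟨(hE j i hji).1.trans hin, hjS, fun k hk => hanc k (hk.tail hji)⟩
          rw [← ih j (hE j i hji).1 hjF]
          by_contra hlt
          exact hanc i .refl ((hZ r i).2 ⟨hiS, j, hjS, hji, not_le.1 hlt⟩)
  have invariant : ∀ r : ℕ, (∀ i, i ∈ S r → i < n ∧ T r i = D i) ∧
      (∀ i, i < n → D i ≤ T r i) ∧ (∀ i, T r i ≤ b i) ∧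
      (∀ j i, j ∈ S r → E j i → T r i ≤ f j i (D j)) := by
    intro r
    induction r with
    | zero =>
      refine ⟨?_, fun i hi => hT0 i ▸ (hD i hi).1, fun i => (hT0 i).le, ?_⟩ <;> simp [hS0]
    | succ r ih =>
      obtain ⟨hfinal, hlower, hb, hrelaxed⟩ := ih
      have hready := ready r hlower hb hrelaxed
      have hlower' : ∀ i, i < n → D i ≤ T (r + 1) i := by
        intro i hi
        rcases (hT r i).2.2 with h | ⟨j, hji, hj, h⟩
        · exact h ▸ hlower i hi
        · rw [h, hready j hj]
          exact (hD i hi).2.1 j hji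
      refine ⟨?_, hlower', fun i => (hT r i).1.trans (hb i), ?_⟩
      · intro i hi
        have hi' : i < n ∧ T r i = D i := by
          rw [hSsucc] at hi
          exact hi.elim (hfinal i) fun h => ⟨((hF r i).1 h).1, hready i h⟩
        exact ⟨hi'.1, le_antisymm ((hT r i).1.trans hi'.2.le) (hlower' i hi'.1)⟩
      · intro j i hj hji
        rw [hSsucc] at hj
        rcases hj with hj | hj
        · exact (hT r i).1.trans (hrelaxed j i hj hji)
        · rw [← hready j hj]
          exact (hT r i).2.1 j hji hj
  exact ⟨fun r => ready r (invariant r).2.1 (invariant r).2.2.1 (invariant r).2.2.2,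
    fun r i hi => ((invariant r).1 i hi).2, fun r => (invariant r).2.1⟩
end

section
/- Progress and termination of the Cordon Algorithm: in every round r, any tentative state i ∉ S_r all of whose proper ancestors lie in S_r belongs to the ready set F_r. Consequently, if d(i) denotes the maximum number of edges on a directed path of the DAG ending at i, then i ∈ S_{d(i)+1} for every state i; in particular S_r = {0,…,n−1} once r exceeds the length of the longest directed path, so the algorithm finalizes all states within (depth of the DAG + 1) rounds. -/
/-- **Progress and termination of the Cordon Algorithm.**
Same setup as for correctness: a DP instance on states `0,…,n−1` with edge
set `E` (topologically ordered by the integers), transitions `f`, boundary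
values `b`; the Cordon Algorithm maintains finalized sets `S r`, tentative
tables `T r`, sentinel sets `Z r` and ready sets `F r` as described.
Let `d i` be the maximum number of edges on a directed path of the DAG
ending at `i` (characterized recursively).

Then: in every round, any tentative state all of whose proper ancestors are
finalized is ready; consequently `i ∈ S (d i + 1)` for every state `i`, and
once `r` exceeds the length of the longest directed path (i.e. `d i < r` for
all states `i`), `S r = {0,…,n−1}` — the algorithm finalizes all states
within depth-of-the-DAG + 1 rounds. -/
theorem cordon_algorithm_progress {α : Type*} [LinearOrder α] (n : ℕ)
    (E : ℕ → ℕ → Prop) (hE : ∀ j i : ℕ, E j i → j < i ∧ i < n)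
    (f : ℕ → ℕ → α → α) (b : ℕ → α)
    (S Z F : ℕ → Set ℕ) (T : ℕ → ℕ → α)
    (hS0 : S 0 = ∅) (hT0 : ∀ i : ℕ, T 0 i = b i)
    (hZ : ∀ r i : ℕ, i ∈ Z r ↔
      i ∉ S r ∧ ∃ j : ℕ, j ∉ S r ∧ E j i ∧ f j i (T r j) < T r i)
    (hF : ∀ r i : ℕ, i ∈ F r ↔
      i < n ∧ i ∉ S r ∧ ∀ j : ℕ, Relation.ReflTransGen E j i → j ∉ Z r)
    (hT : ∀ r i : ℕ,
      T (r + 1) i ≤ T r i ∧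
      (∀ j : ℕ, E j i → j ∈ F r → T (r + 1) i ≤ f j i (T r j)) ∧
      (T (r + 1) i = T r i ∨
        ∃ j : ℕ, E j i ∧ j ∈ F r ∧ T (r + 1) i = f j i (T r j)))
    (hSsucc : ∀ r : ℕ, S (r + 1) = S r ∪ F r)
    (d : ℕ → ℕ)
    (hd : ∀ i : ℕ, i < n →
      (∀ j : ℕ, E j i → d j + 1 ≤ d i) ∧
      (d i = 0 ∨ ∃ j : ℕ, E j i ∧ d i = d j + 1)) :
    (∀ r i : ℕ, i < n → i ∉ S r →
      (∀ j : ℕ, Relation.ReflTransGen E j i → j ≠ i → j ∈ S r) → i ∈ F r) ∧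
    (∀ i : ℕ, i < n → i ∈ S (d i + 1)) ∧
    (∀ r : ℕ, (∀ i : ℕ, i < n → d i < r) → S r = {i : ℕ | i < n}) := by
  have ready : ∀ r i : ℕ, i < n → i ∉ S r →
      (∀ j : ℕ, Relation.ReflTransGen E j i → j ≠ i → j ∈ S r) → i ∈ F r := by
    intro r i hi hiS hanc
    refine (hF r i).2 ⟨hi, hiS, fun j hji hjZ => ?_⟩
    obtain ⟨hjS, k, hkS, hkj, -⟩ := (hZ r j).1 hjZ
    have hj : j = i := by
      by_contra hne
      exact hjS (hanc j hji hne)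
    subst hj
    exact hkS (hanc k (.single hkj) (hE k j hkj).1.ne)
  have depth_lt : ∀ j i : ℕ, Relation.ReflTransGen E j i → j = i ∨ j < n ∧ d j < d i := by
    intro j i h
    induction h with
    | refl => exact .inl rfl
    | tail _ hki ih =>
      have hlt := hE _ _ hki
      have hdk := (hd _ hlt.2).1 _ hki
      rcases ih with rfl | ih
      · exact .inr ⟨by omega, by omega⟩
      · exact .inr ⟨ih.1, by omega⟩
  have finalized : ∀ r i : ℕ, i < n → d i < r → i ∈ S r := by
    intro r
    induction r with
    | zero => intro i _ h; omega
    | succ r ih =>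
      intro i hi hdi
      rw [hSsucc]
      by_cases hiS : i ∈ S r
      · exact .inl hiS
      · refine .inr (ready r i hi hiS fun j hji hne => ?_)
        obtain ⟨hj, hdj⟩ := (depth_lt j i hji).resolve_left hne
        exact ih j hj (by omega)
  have S_subset : ∀ r i : ℕ, i ∈ S r → i < n := by
    intro r
    induction r with
    | zero => simp [hS0]
    | succ r ih =>
      intro i hi
      rw [hSsucc] at hi
      exact hi.elim (ih i) fun h => ((hF r i).1 h).1
  exact ⟨ready, fun i hi => finalized _ i hi (Nat.lt_succ_self _),
    fun r hr => Set.ext fun i => ⟨S_subset r i, fun hi => finalized r i hi (hr i hi)⟩⟩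
end

section
/- Mapping LCS to LIS: list all pairs (i,j) with A(i) = B(j), sorted by increasing first coordinate and, among pairs with equal first coordinate, by decreasing second coordinate; let s_1, s_2, …, s_L be the second coordinates of the pairs in this order. Then LCS(A,B) equals the length of the longest strictly increasing subsequence of the sequence s_1,…,s_L. -/
/-- `LCS A B`: the maximum length of a common (not necessarily contiguous)
subsequence of the lists `A` and `B`. -/
noncomputable def LCS {γ : Type*} [DecidableEq γ] (A B : List γ) : ℕ :=
  sSup {k | ∃ C : List γ, C.Sublist A ∧ C.Sublist B ∧ C.length = k}

/-- `LIS l`: the maximum length of a strictly increasing (not necessarily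
contiguous) subsequence of the list `l`. -/
noncomputable def LIS (l : List ℕ) : ℕ :=
  sSup {k | ∃ C : List ℕ, C.Sublist l ∧ C.Chain' (· < ·) ∧ C.length = k}

/-- A strictly increasing list is a subsequence of the match sequence of `I` and `J` exactly when
its entries lie in `J` and its image under `B` is a subsequence of `I.map A`. -/
theorem sublist_matchSequence_iff {γ : Type*} [DecidableEq γ] (A B : ℕ → γ) {J : List ℕ}
    (hJ : J.Pairwise (· < ·)) (I : List ℕ) {D : List ℕ} (hD : D.Pairwise (· < ·)) :
    D.Sublist (I.flatMap fun i => J.reverse.filter fun j => decide (A i = B j)) ↔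
      D ⊆ J ∧ (D.map B).Sublist (I.map A) := by
  induction I generalizing D with
  | nil => simp +contextual
  | cons i I ih =>
    rw [List.flatMap_cons, List.map_cons]
    constructor
    · intro h
      obtain ⟨D₁, D₂, rfl, h₁, h₂⟩ := List.sublist_append_iff.1 h
      have hdec : D₁.Pairwise (· > ·) :=
        List.Pairwise.sublist (h₁.trans List.filter_sublist) (List.pairwise_reverse.2 hJ)
      obtain ⟨hinc, hD₂, -⟩ := List.pairwise_append.1 hD
      obtain ⟨hsub, hmap⟩ := (ih hD₂).1 h₂
      match D₁, hdec, hinc, h₁ with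
      | [], _, _, _ => exact ⟨hsub, hmap.cons _⟩
      | [d], _, _, h₁ =>
        have hd := h₁.subset (List.mem_singleton_self d)
        simp only [List.mem_filter, List.mem_reverse, decide_eq_true_eq] at hd
        refine ⟨List.cons_subset.2 ⟨hd.1, hsub⟩, ?_⟩
        rw [List.singleton_append, List.map_cons, hd.2]
        exact hmap.cons_cons _
      | a :: b :: _, hdec, hinc, _ =>
        have hba := List.rel_of_pairwise_cons hdec List.mem_cons_self
        have hab := List.rel_of_pairwise_cons hinc List.mem_cons_self
        exact absurd hab hba.asymm
    · rintro ⟨hsub, hmap⟩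
      rcases List.sublist_cons_iff.1 hmap with h | ⟨r, hr, h⟩
      · exact ((ih hD).2 ⟨hsub, h⟩).trans (List.sublist_append_right _ _)
      · obtain ⟨d, D', rfl, hd, rfl⟩ := List.map_eq_cons_iff.1 hr
        obtain ⟨hdJ, hsub'⟩ := List.cons_subset.1 hsub
        refine List.Sublist.append (l₁ := [d]) (List.singleton_sublist.2 ?_)
          ((ih hD.of_cons).2 ⟨hsub', h⟩)
        simp [hdJ, hd]

/-- **Mapping LCS to LIS.**
Let `A : {1,…,n} → γ` and `B : {1,…,m} → γ`.  List all pairs `(i,j)` with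
`A i = B j`, sorted by increasing first coordinate and, among pairs with
equal first coordinate, by decreasing second coordinate; let `s` be the
resulting sequence of second coordinates.  Then `LCS(A,B)` equals the length
of the longest strictly increasing subsequence of `s`. -/
theorem lcs_eq_lis_of_match_sequence {γ : Type*} [DecidableEq γ]
    (n m : ℕ) (A B : ℕ → γ) :
    LCS ((List.range' 1 n).map A) ((List.range' 1 m).map B) =
      LIS ((List.range' 1 n).flatMap (fun i =>
        (List.range' 1 m).reverse.filter (fun j => decide (A i = B j)))) := by
  have hJ : (List.range' 1 m).Pairwise (· < ·) := List.pairwise_lt_range'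
  unfold LCS LIS
  congr 1
  ext k
  simp only [Set.mem_ofPred_eq]
  constructor
  · rintro ⟨C, hA, hB, rfl⟩
    obtain ⟨D, hD, rfl⟩ := List.sublist_map_iff.1 hB
    have hinc := hJ.sublist hD
    exact ⟨D, (sublist_matchSequence_iff A B hJ _ hinc).2 ⟨hD.subset, hA⟩,
      List.isChain_iff_pairwise.2 hinc, (List.length_map _).symm⟩
  · rintro ⟨D, hD, hchain, rfl⟩
    have hinc := List.isChain_iff_pairwise.1 hchain
    obtain ⟨hsub, hA⟩ := (sublist_matchSequence_iff A B hJ _ hinc).1 hD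
    have hDJ : D.Sublist (List.range' 1 m) :=
      List.sublist_of_subperm_of_pairwise (hinc.nodup.subperm hsub) hinc hJ
    exact ⟨D.map B, hA, hDJ.map B, List.length_map _⟩
end

section
/- Minimal points of LCS level sets are matches: for every r ≥ 1 and all 1 ≤ i ≤ n, 1 ≤ j ≤ m, if D(i,j) ≥ r while D(i−1,j) < r and D(i,j−1) < r, then A(i) = B(j) and D(i,j) = r. That is, every minimal element, under the coordinatewise order, of the level set {(i,j) : D(i,j) ≥ r} is a matching position whose DP value is exactly r. -/
/-- Horizontally adjacent entries of an LCS table differ by `0` or `1`. -/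
theorem lcs_row_step {γ : Type*} (n m : ℕ) (A B : ℕ → γ) (D : ℕ → ℕ → ℕ)
    (hrow0 : ∀ j : ℕ, D 0 j = 0) (hcol0 : ∀ i : ℕ, D i 0 = 0)
    (hmatch : ∀ i j : ℕ, 1 ≤ i → i ≤ n → 1 ≤ j → j ≤ m → A i = B j →
      D i j = D (i - 1) (j - 1) + 1)
    (hmismatch : ∀ i j : ℕ, 1 ≤ i → i ≤ n → 1 ≤ j → j ≤ m → A i ≠ B j →
      D i j = max (D (i - 1) j) (D i (j - 1))) :
    ∀ i j : ℕ, i ≤ n → j < m → D i j ≤ D i (j + 1) ∧ D i (j + 1) ≤ D i j + 1 := by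
  have cell : ∀ i j : ℕ, i < n → j < m → D (i + 1) (j + 1) = D i j + 1 ∨
      D (i + 1) (j + 1) = max (D i (j + 1)) (D (i + 1) j) := by
    intro i j hi hj
    by_cases h : A (i + 1) = B (j + 1)
    · exact .inl (hmatch (i + 1) (j + 1) (by omega) hi (by omega) hj h)
    · exact .inr (hmismatch (i + 1) (j + 1) (by omega) hi (by omega) hj h)
  intro i
  induction i with
  | zero => simp [hrow0]
  | succ i row =>
    have col : ∀ j : ℕ, i < n → j ≤ m → D i j ≤ D (i + 1) j ∧ D (i + 1) j ≤ D i j + 1 := by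
      intro j
      induction j with
      | zero => simp [hcol0]
      | succ j col =>
        intro hi hj
        have := col hi (by omega)
        have := row j hi.le hj
        have := cell i j hi hj
        omega
    intro j hi hj
    have := col j hi hj.le
    have := row j (by omega) hj
    have := cell i j hi hj
    omega

/-- **Minimal points of LCS level sets are matches.**
Let `A : {1,…,n} → γ` and `B : {1,…,m} → γ`, and let `D` satisfy the standard
LCS recurrence.  For every `r ≥ 1` and `1 ≤ i ≤ n`, `1 ≤ j ≤ m`, if
`D i j ≥ r` while `D (i−1) j < r` and `D i (j−1) < r`, then `A i = B j` and
`D i j = r`: every coordinatewise-minimal element of the level set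
`{(i,j) : D i j ≥ r}` is a matching position with DP value exactly `r`. -/
theorem lcs_level_set_minimal_points {γ : Type*} [DecidableEq γ]
    (n m : ℕ) (A B : ℕ → γ) (D : ℕ → ℕ → ℕ)
    (hrow0 : ∀ j : ℕ, D 0 j = 0) (hcol0 : ∀ i : ℕ, D i 0 = 0)
    (hmatch : ∀ i j : ℕ, 1 ≤ i → i ≤ n → 1 ≤ j → j ≤ m → A i = B j →
      D i j = D (i - 1) (j - 1) + 1)
    (hmismatch : ∀ i j : ℕ, 1 ≤ i → i ≤ n → 1 ≤ j → j ≤ m → A i ≠ B j →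
      D i j = max (D (i - 1) j) (D i (j - 1))) :
    ∀ r i j : ℕ, 1 ≤ r → 1 ≤ i → i ≤ n → 1 ≤ j → j ≤ m →
      r ≤ D i j → D (i - 1) j < r → D i (j - 1) < r →
      A i = B j ∧ D i j = r := by
  intro r i j _ hi hin hj hjm hr hup hleft
  by_cases h : A i = B j
  · have hD := hmatch i j hi hin hj hjm h
    have hrow := (lcs_row_step n m A B D hrow0 hcol0 hmatch hmismatch
      (i - 1) (j - 1) (by omega) (by omega)).1
    rw [Nat.sub_add_cancel hj] at hrow
    exact ⟨h, by omega⟩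
  · have hD := hmismatch i j hi hin hj hjm h
    omega
end

section
/- Convex decision monotonicity: let w satisfy the convex quadrangle inequality and let E : ℕ → ℝ. For each i ≥ 1 define best(i) as the least j ∈ {0,…,i−1} minimizing E(j) + w(j,i). Then best is nondecreasing: 1 ≤ i ≤ i' implies best(i) ≤ best(i'). -/
/-- **Convex decision monotonicity.**
If `w` satisfies the convex quadrangle inequality and `best i` is the least
`j ∈ {0,…,i−1}` minimizing `E j + w j i`, then `best` is nondecreasing. -/
theorem convex_decision_monotonicity (w : ℕ → ℕ → ℝ)
    (hw : ∀ a b c d : ℕ, a ≤ b → b ≤ c → c ≤ d → w a c + w b d ≤ w a d + w b c)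
    (E : ℕ → ℝ) (best : ℕ → ℕ)
    (hbest : ∀ i : ℕ, 1 ≤ i →
      best i < i ∧
      (∀ j : ℕ, j < i → E (best i) + w (best i) i ≤ E j + w j i) ∧
      (∀ j : ℕ, j < best i → E (best i) + w (best i) i < E j + w j i)) :
    ∀ i i' : ℕ, 1 ≤ i → i ≤ i' → best i ≤ best i' := by
  intro i i' hi hii'
  by_contra! hlt
  obtain ⟨hbi, -, hleast⟩ := hbest i hi
  obtain ⟨-, hmin, -⟩ := hbest i' (hi.trans hii')
  linarith [hw (best i') (best i) i i' hlt.le hbi.le hii',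
    hleast (best i') hlt, hmin (best i) (hbi.trans_le hii')]
end

section
/- Concave decision monotonicity: let w satisfy the concave quadrangle inequality and let E : ℕ → ℝ. For each i ≥ 1 define best(i) as the least j ∈ {0,…,i−1} minimizing E(j) + w(j,i). Then for all 1 ≤ i < i', either best(i') ≤ best(i) or best(i') ≥ i; that is, it is impossible that best(i) < best(i') < i. -/
/-- **Concave decision monotonicity.**
If `w` satisfies the concave quadrangle inequality and `best i` is the least
`j ∈ {0,…,i−1}` minimizing `E j + w j i`, then for all `1 ≤ i < i'`, either
`best i' ≤ best i` or `best i' ≥ i`. -/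
theorem concave_decision_monotonicity (w : ℕ → ℕ → ℝ)
    (hw : ∀ a b c d : ℕ, a ≤ b → b ≤ c → c ≤ d → w a d + w b c ≤ w a c + w b d)
    (E : ℕ → ℝ) (best : ℕ → ℕ)
    (hbest : ∀ i : ℕ, 1 ≤ i →
      best i < i ∧
      (∀ j : ℕ, j < i → E (best i) + w (best i) i ≤ E j + w j i) ∧
      (∀ j : ℕ, j < best i → E (best i) + w (best i) i < E j + w j i)) :
    ∀ i i' : ℕ, 1 ≤ i → i < i' → best i' ≤ best i ∨ i ≤ best i' := by
  intro i i' hi hii'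
  by_contra! h
  obtain ⟨hlt, hlt'⟩ := h
  have hmin := (hbest i hi).2.1 (best i') hlt'
  have hleast := (hbest i' (hi.trans hii'.le)).2.2 (best i) hlt
  have hquad := hw (best i) (best i') i i' hlt.le hlt'.le hii'.le
  linarith
end

section
/- Rotation inequality for optimal alphabetic trees: let T be an optimal alphabetic tree. If e is an internal node of T whose left child c is internal with left child a, and d is the right child of e, then w(a) ≤ w(d). Symmetrically, if e has left child d' and its right child c' is internal with right child a', then w(a') ≤ w(d'). -/
/-- Binary trees in which every internal node has exactly two children and
every leaf carries a nonnegative real weight. -/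
inductive WTree : Type
  | leaf : ℝ → WTree
  | node : WTree → WTree → WTree

namespace WTree

/-- The weights of the leaves in left-to-right order. -/
def leaves : WTree → List ℝ
  | leaf x => [x]
  | node l r => leaves l ++ leaves r

/-- The total weight of the leaves of a tree. -/
def wt (t : WTree) : ℝ := t.leaves.sum

/-- The cost `Σ aᵢ dᵢ` of an alphabetic tree (each leaf weight times its
depth), computed recursively. -/
def cost : WTree → ℝ
  | leaf _ => 0
  | node l r => cost l + cost r + wt l + wt r

/-- `t` is an optimal alphabetic tree: it minimizes cost among all alphabetic
trees on the same left-to-right sequence of leaf weights. -/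
def IsOAT (t : WTree) : Prop :=
  ∀ t' : WTree, t'.leaves = t.leaves → cost t ≤ cost t'

/-- `IsSubtree s t`: `s` occurs as (the subtree rooted at) a node of `t`. -/
inductive IsSubtree : WTree → WTree → Prop
  | refl (t : WTree) : IsSubtree t t
  | left {s l r : WTree} : IsSubtree s l → IsSubtree s (node l r)
  | right {s l r : WTree} : IsSubtree s r → IsSubtree s (node l r)

end WTree

namespace WTree

theorem wt_node (l r : WTree) : (node l r).wt = l.wt + r.wt := by
  simp [wt, leaves]

theorem wt_eq_of_leaves_eq {s t : WTree} (h : s.leaves = t.leaves) : s.wt = t.wt := by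
  rw [wt, wt, h]

/-- Every subtree of an optimal alphabetic tree is optimal. -/
theorem IsOAT.of_isSubtree {s t : WTree} (hst : IsSubtree s t) (ht : t.IsOAT) : s.IsOAT := by
  induction hst with
  | refl => exact ht
  | @left l r _ ih =>
    refine ih fun l' hl' => ?_
    have h := ht (node l' r) (by simp only [leaves, hl'])
    simp only [cost, wt_eq_of_leaves_eq hl'] at h
    linarith
  | @right l r _ ih =>
    refine ih fun r' hr' => ?_
    have h := ht (node l r') (by simp only [leaves, hr'])
    simp only [cost, wt_eq_of_leaves_eq hr'] at h
    linarith

end WTree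

/-- **Rotation inequality for optimal alphabetic trees.**
In an optimal alphabetic tree `T` (with nonnegative weights):
if an internal node `e` has internal left child `c = node a b` and right child
`d`, then `w(a) ≤ w(d)`; symmetrically, if `e` has left child `d'` and
internal right child `c' = node b' a'`, then `w(a') ≤ w(d')`. -/
theorem oat_rotation_inequality (T : WTree)
    (hnn : ∀ x ∈ T.leaves, (0 : ℝ) ≤ x) (hopt : T.IsOAT) :
    (∀ a b d : WTree,
      WTree.IsSubtree (WTree.node (WTree.node a b) d) T → a.wt ≤ d.wt) ∧
    (∀ d' b' a' : WTree,
      WTree.IsSubtree (WTree.node d' (WTree.node b' a')) T → a'.wt ≤ d'.wt) := by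
  constructor
  · intro a b d hs
    have h := WTree.IsOAT.of_isSubtree hs hopt (.node a (.node b d))
      (by simp only [WTree.leaves, List.append_assoc])
    simp only [WTree.cost, WTree.wt_node] at h
    linarith
  · intro d b a hs
    have h := WTree.IsOAT.of_isSubtree hs hopt (.node (.node d b) a)
      (by simp only [WTree.leaves, List.append_assoc])
    simp only [WTree.cost, WTree.wt_node] at h
    linarith
end
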